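/- Consider the physical fractional Brownian motion model with Hurst parameter H ∈ (0,1), noise intensity σ > 0 and scale-separation parameter ε > 0, and fix a horizon T > 0. Let 0 < α < min{1, H/(1−H)} and couple the sampling rate to the scale separation by δ = ε^α. Then, as ε → 0⁺ (along values of ε for which N = T/δ is a positive integer), the estimator σ̂²_{ε,δ} converges to σ² in L²(Ω), i.e. E[(σ̂²_{ε,δ} − σ²)²] → 0. -/

import Mathlib

open MeasureTheory ProbabilityTheory Filter Matrix Topology

noncomputable section

/-- Covariance function of two-sided fractional Brownian motion with Hurst parameter `H`. -/
def fbmCov (H s t : ℝ) : ℝ :=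
  (|s| ^ (2 * H) + |t| ^ (2 * H) - |s - t| ^ (2 * H)) / 2

/-- `B` is a two-sided fractional Brownian motion with Hurst parameter `H`:
a.s. continuous paths, `B 0 = 0`, and all finite-dimensional marginals are centered
Gaussian with covariance `fbmCov H`. -/
structure IsTwoSidedFBM {Ω : Type*} [MeasureSpace Ω] (H : ℝ) (B : ℝ → Ω → ℝ) : Prop where
  meas : ∀ t, Measurable (B t)
  cont : ∀ᵐ ω : Ω, Continuous fun t => B t ω
  zero : ∀ᵐ ω : Ω, B 0 ω = 0
  gaussian : ∀ (n : ℕ) (t a : Fin n → ℝ),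
    Measure.map (fun ω => ∑ i, a i * B (t i) ω) (ℙ : Measure Ω)
      = gaussianReal 0 (∑ i, ∑ j, a i * a j * fbmCov H (t i) (t j)).toNNReal

/-- The stationary fractional Ornstein–Uhlenbeck process
`Y^ε_t = (σ/ε^H)(B^H_t − (1/ε)∫_{−∞}^t e^{−(t−s)/ε} B^H_s ds)`. -/
def fracOU {Ω : Type*} [MeasureSpace Ω] (H σ ε : ℝ) (B : ℝ → Ω → ℝ) (t : ℝ) (ω : Ω) : ℝ :=
  (σ / ε ^ H) * (B t ω - (1 / ε) * ∫ s in Set.Iic t, Real.exp (-(t - s) / ε) * B s ω)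

/-- The slow component `X^ε_t = ε^{H−1} ∫_0^t Y^ε_s ds` of the physical fractional
Brownian motion model. -/
def slowX {Ω : Type*} [MeasureSpace Ω] (H σ ε : ℝ) (B : ℝ → Ω → ℝ) (t : ℝ) (ω : Ω) : ℝ :=
  ε ^ (H - 1) * ∫ s in (0 : ℝ)..t, fracOU H σ ε B s ω

/-- Covariance matrix of the increments, over a grid of mesh `δ`, of fractional Brownian
motion with Hurst parameter `H`. -/
def SigmaH (H δ : ℝ) (N : ℕ) : Matrix (Fin N) (Fin N) ℝ := fun i j =>
  δ ^ (2 * H) / 2 *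
    (|(i : ℝ) - (j : ℝ) + 1| ^ (2 * H) + |(i : ℝ) - (j : ℝ) - 1| ^ (2 * H)
      - 2 * |(i : ℝ) - (j : ℝ)| ^ (2 * H))

/-- Vector of increments of the slow component over the grid of mesh `δ`. -/
def incVec {Ω : Type*} [MeasureSpace Ω] (H σ ε δ : ℝ) (B : ℝ → Ω → ℝ) (N : ℕ) (ω : Ω) :
    Fin N → ℝ := fun k =>
  slowX H σ ε B (((k : ℕ) + 1 : ℝ) * δ) ω - slowX H σ ε B ((k : ℕ) * δ) ω

/-- The maximum-likelihood-type estimator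
`σ̂²_{ε,δ} = (1/N) Vᵀ (Σ^H_{δ,N})⁻¹ V`. -/
def sigmaHat2 {Ω : Type*} [MeasureSpace Ω] (H σ ε δ : ℝ) (B : ℝ → Ω → ℝ) (N : ℕ) (ω : Ω) : ℝ :=
  (1 / (N : ℝ)) * (incVec H σ ε δ B N ω ⬝ᵥ ((SigmaH H δ N)⁻¹ *ᵥ incVec H σ ε δ B N ω))


/-- The fourth moment of a centered real Gaussian. -/
lemma integral_pow_four_gaussianReal (v : NNReal) :
    ∫ x, x ^ 4 ∂(gaussianReal 0 v) = 3 * (v : ℝ) ^ 2 := by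
  have h := iteratedDeriv_mgf_zero (X := id) (μ := gaussianReal 0 v) (by simp) 4
  rw [mgf_id_gaussianReal] at h
  simp only [id, Pi.pow_apply] at h
  rw [← h]
  have step : ∀ p p' : ℝ → ℝ, (∀ t, HasDerivAt p (p' t) t) →
      deriv (fun t => p t * Real.exp (0 * t + v * t ^ 2 / 2)) =
        fun t => (p' t + p t * (v * t)) * Real.exp (0 * t + v * t ^ 2 / 2) := by
    intro p p' hp
    ext t
    have h1 : HasDerivAt (fun t : ℝ => 0 * t + v * t ^ 2 / 2) (v * t) t := by
      have := (((hasDerivAt_id t).const_mul 0).add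
        ((((hasDerivAt_id t).pow 2).const_mul (v : ℝ)).div_const 2))
      refine this.congr_deriv ?_
      simp; ring
    rw [((hp t).fun_mul h1.exp).deriv]
    ring
  rw [iteratedDeriv_succ, iteratedDeriv_succ, iteratedDeriv_succ, iteratedDeriv_one]
  have e0 : (fun t : ℝ => Real.exp (0 * t + v * t ^ 2 / 2)) =
      fun t : ℝ => (1 : ℝ) * Real.exp (0 * t + v * t ^ 2 / 2) := by simp
  rw [e0, step (fun _ => 1) (fun _ => 0) (fun t => hasDerivAt_const t 1),
    step (fun t => 0 + 1 * (v * t)) (fun _ => v) (fun t => by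
      simpa using (hasDerivAt_id t).const_mul (v : ℝ)),
    step (fun t => v + (0 + 1 * (v * t)) * (v * t)) (fun t => 2 * v ^ 2 * t) (fun t => by
      have := (((hasDerivAt_id t).pow 2).const_mul ((v : ℝ) ^ 2)).const_add (v : ℝ)
      refine (this.congr_deriv ?_).congr_of_eventuallyEq (Eventually.of_forall fun s => ?_)
      · simp; ring
      · simp; ring),
    step _ (fun t => 3 * v ^ 2 + 3 * v ^ 3 * t ^ 2) (fun t => by
      have := ((hasDerivAt_id t).const_mul (3 * (v : ℝ) ^ 2)).add
        (((hasDerivAt_id t).pow 3).const_mul ((v : ℝ) ^ 3))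
      refine (this.congr_deriv ?_).congr_of_eventuallyEq (Eventually.of_forall fun s => ?_)
      · simp; ring
      · simp; ring)]
  simp

/-- A positive definite matrix whose quadratic form dominates `c` times the squared norm has an
inverse of the form `Aᵀ A`, with `A M Aᵀ = 1` and `‖A y‖² ≤ c⁻¹ ‖y‖²`. -/
lemma exists_whitening {n : ℕ} (M : Matrix (Fin n) (Fin n) ℝ) (hM : M.IsSymm) {c : ℝ} (hc : 0 < c)
    (h : ∀ x : Fin n → ℝ, c * (x ⬝ᵥ x) ≤ x ⬝ᵥ (M *ᵥ x)) :
    ∃ A : Matrix (Fin n) (Fin n) ℝ,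
      (∀ y, y ⬝ᵥ (M⁻¹ *ᵥ y) = (A *ᵥ y) ⬝ᵥ (A *ᵥ y)) ∧ A * M * Aᵀ = 1 ∧
      ∀ y, (A *ᵥ y) ⬝ᵥ (A *ᵥ y) ≤ c⁻¹ * (y ⬝ᵥ y) := by
  have hpos : M.PosDef := by
    refine Matrix.PosDef.of_dotProduct_mulVec_pos ?_ ?_
    · rw [Matrix.IsHermitian, Matrix.conjTranspose_eq_transpose_of_trivial]; exact hM
    · intro x hx
      have h1 : 0 < x ⬝ᵥ x := by
        have := Matrix.dotProduct_star_self_pos_iff.2 hx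
        simpa using this
      simpa using lt_of_lt_of_le (mul_pos hc h1) (h x)
  have hu : IsUnit M.det := (Matrix.isUnit_iff_isUnit_det _).1 hpos.isUnit
  have hinv := hpos.inv.posSemidef
  open scoped MatrixOrder in
  obtain ⟨A, hA⟩ := CStarAlgebra.nonneg_iff_eq_star_mul_self.mp hinv.nonneg
  rw [Matrix.star_eq_conjTranspose, Matrix.conjTranspose_eq_transpose_of_trivial] at hA
  have hq : ∀ y, y ⬝ᵥ (M⁻¹ *ᵥ y) = (A *ᵥ y) ⬝ᵥ (A *ᵥ y) := by
    intro y
    rw [hA, ← Matrix.mulVec_mulVec, Matrix.dotProduct_mulVec, Matrix.vecMul_transpose]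
  refine ⟨A, hq, ?_, ?_⟩
  · have h1 : Aᵀ * (A * M) = 1 := by
      rw [← Matrix.mul_assoc, ← hA, Matrix.nonsing_inv_mul _ hu]
    exact mul_eq_one_comm.1 h1
  · intro y
    rw [← hq]
    set x := M⁻¹ *ᵥ y with hx
    have hMx : M *ᵥ x = y := by
      rw [hx, Matrix.mulVec_mulVec, Matrix.mul_nonsing_inv _ hu, Matrix.one_mulVec]
    have h1 := h x
    rw [hMx] at h1
    have h2 : 0 ≤ (c • x - y) ⬝ᵥ (c • x - y) := 
      Finset.sum_nonneg fun i _ => mul_self_nonneg _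
    simp only [sub_dotProduct, dotProduct_sub, smul_dotProduct, dotProduct_smul, smul_eq_mul] at h2
    rw [dotProduct_comm x y] at h1 h2
    rw [inv_mul_eq_div, le_div_iff₀ hc]
    nlinarith

section GaussianVector

variable {Ω : Type*} [MeasurableSpace Ω] {P : Measure Ω}

lemma integrable_pow_four_of_gaussian {X : Ω → ℝ} (hX : Measurable X) {v : NNReal}
    (h : P.map X = gaussianReal 0 v) : Integrable (fun ω => X ω ^ 4) P := by
  have h1 : Integrable (fun x : ℝ => x ^ 4) (P.map X) := by
    rw [h]
    have := (memLp_id_gaussianReal (μ := 0) (v := v) 4).integrable_norm_pow (p := 4) (by norm_num)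
    simpa [Even.pow_abs (by decide : Even 4)] using this
  exact h1.comp_measurable hX

lemma integral_pow_four_of_gaussian {X : Ω → ℝ} (hX : Measurable X) {v : NNReal}
    (h : P.map X = gaussianReal 0 v) : ∫ ω, X ω ^ 4 ∂P = 3 * (v : ℝ) ^ 2 := by
  rw [← integral_pow_four_gaussianReal v, ← h, integral_map hX.aemeasurable (by fun_prop)]

lemma integrable_sq_of_gaussian {X : Ω → ℝ} (hX : Measurable X) {v : NNReal}
    (h : P.map X = gaussianReal 0 v) : Integrable (fun ω => X ω ^ 2) P := by
  have h1 : Integrable (fun x : ℝ => x ^ 2) (P.map X) := by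
    rw [h]
    have := (memLp_id_gaussianReal (μ := 0) (v := v) 2).integrable_norm_pow (p := 2) (by norm_num)
    simpa using this
  exact h1.comp_measurable hX

lemma integral_sq_of_gaussian {X : Ω → ℝ} (hX : Measurable X) {v : NNReal}
    (h : P.map X = gaussianReal 0 v) : ∫ ω, X ω ^ 2 ∂P = v := by
  have h1 := variance_fun_id_gaussianReal (μ := 0) (v := v)
  rw [variance_eq_integral measurable_id'.aemeasurable] at h1
  simp only [integral_id_gaussianReal, sub_zero] at h1
  rw [← h1, ← h, integral_map hX.aemeasurable (by fun_prop)]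

variable [IsProbabilityMeasure P] {n : ℕ}

/-- If all linear combinations of `Z` have the law they would have for a standard Gaussian vector
of dimension `n`, then `‖Z‖²` has the second centered moment `2 n` of the `χ²` distribution. -/
lemma integral_chiSq_sub_sq {Z : Fin n → Ω → ℝ} (hZ : ∀ i, Measurable (Z i))
    (hlaw : ∀ a : Fin n → ℝ,
      P.map (fun ω => ∑ i, a i * Z i ω) = gaussianReal 0 (∑ i, a i * a i).toNNReal) :
    Integrable (fun ω => ((∑ i, Z i ω * Z i ω) - n) ^ 2) P ∧
      ∫ ω, ((∑ i, Z i ω * Z i ω) - n) ^ 2 ∂P = 2 * n := by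
  classical
  have hlaw2 : ∀ i j (a b : ℝ), i ≠ j →
      P.map (fun ω => a * Z i ω + b * Z j ω) = gaussianReal 0 (a * a + b * b).toNNReal := by
    intro i j a b hij
    have h := hlaw (Pi.single i a + Pi.single j b)
    have e1 : (fun ω => ∑ k, (Pi.single i a + Pi.single j b : Fin n → ℝ) k * Z k ω) =
        fun ω => a * Z i ω + b * Z j ω := by
      ext ω
      simp [add_mul, Finset.sum_add_distrib, Pi.single_apply]
    have e2 : ∑ k, (Pi.single i a + Pi.single j b : Fin n → ℝ) k *
        (Pi.single i a + Pi.single j b : Fin n → ℝ) k = a * a + b * b := by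
      simp [add_mul, mul_add, Finset.sum_add_distrib, Pi.single_apply, hij, hij.symm]
    rw [e1, e2] at h
    exact h
  have hlaw1 : ∀ i, P.map (Z i) = gaussianReal 0 1 := by
    intro i
    have h := hlaw (Pi.single i 1)
    simpa [Pi.single_apply] using h
  have I4 := fun i => integrable_pow_four_of_gaussian (hZ i) (hlaw1 i)
  have E4 := fun i => integral_pow_four_of_gaussian (hZ i) (hlaw1 i)
  have I2 := fun i => integrable_sq_of_gaussian (hZ i) (hlaw1 i)
  have E2 := fun i => integral_sq_of_gaussian (hZ i) (hlaw1 i)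
  have mixed : ∀ i j, i ≠ j → Integrable (fun ω => Z i ω ^ 2 * Z j ω ^ 2) P ∧
      ∫ ω, Z i ω ^ 2 * Z j ω ^ 2 ∂P = 1 := by
    intro i j hij
    have hp := hlaw2 i j 1 1 hij
    have hm := hlaw2 i j 1 (-1) hij
    have mp : Measurable fun ω => 1 * Z i ω + 1 * Z j ω := by fun_prop
    have mm : Measurable fun ω => 1 * Z i ω + (-1) * Z j ω := by fun_prop
    have Ip := integrable_pow_four_of_gaussian mp hp
    have Im := integrable_pow_four_of_gaussian mm hm
    have Ep := integral_pow_four_of_gaussian mp hp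
    have Em := integral_pow_four_of_gaussian mm hm
    have e : (fun ω => Z i ω ^ 2 * Z j ω ^ 2) = fun ω =>
        (1 / 12 : ℝ) * (((1 * Z i ω + 1 * Z j ω) ^ 4 + (1 * Z i ω + (-1) * Z j ω) ^ 4) -
          2 * (Z i ω ^ 4 + Z j ω ^ 4)) := by
      ext ω; ring
    rw [e]
    have Ia := Ip.fun_add Im
    have Ib := ((I4 i).fun_add (I4 j)).const_mul 2
    refine ⟨(Ia.sub Ib).const_mul _, ?_⟩
    rw [integral_const_mul, integral_sub Ia Ib, integral_const_mul, integral_add Ip Im,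
      integral_add (I4 i) (I4 j), Ep, Em, E4, E4]
    norm_num [Real.coe_toNNReal]
  have key : ∀ i j, Integrable (fun ω => (Z i ω ^ 2 - 1) * (Z j ω ^ 2 - 1)) P ∧
      ∫ ω, (Z i ω ^ 2 - 1) * (Z j ω ^ 2 - 1) ∂P = if i = j then 2 else 0 := by
    intro i j
    have main : Integrable (fun ω => Z i ω ^ 2 * Z j ω ^ 2) P ∧
      ∫ ω, Z i ω ^ 2 * Z j ω ^ 2 ∂P = if i = j then 3 else 1 := by
      by_cases hij : i = j
      · subst hij
        have e : (fun ω => Z i ω ^ 2 * Z i ω ^ 2) = fun ω => Z i ω ^ 4 := by ext; ring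
        rw [e]
        refine ⟨I4 i, ?_⟩
        rw [E4]; simp
      · simpa [hij] using mixed i j hij
    have e : (fun ω => (Z i ω ^ 2 - 1) * (Z j ω ^ 2 - 1)) = fun ω =>
        Z i ω ^ 2 * Z j ω ^ 2 - (Z i ω ^ 2 + Z j ω ^ 2) + 1 := by ext; ring
    rw [e]
    have Ia := (I2 i).fun_add (I2 j)
    have Ib : Integrable (fun ω => Z i ω ^ 2 * Z j ω ^ 2 - (Z i ω ^ 2 + Z j ω ^ 2)) P :=
      main.1.sub Ia
    refine ⟨Ib.add (integrable_const 1), ?_⟩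
    rw [integral_add Ib (integrable_const 1), integral_sub main.1 Ia, integral_add (I2 i) (I2 j),
      main.2, E2, E2]
    split_ifs <;> norm_num
  have e : (fun ω => ((∑ i, Z i ω * Z i ω) - n) ^ 2) = fun ω =>
      ∑ i, ∑ j, (Z i ω ^ 2 - 1) * (Z j ω ^ 2 - 1) := by
    ext ω
    rw [← Finset.sum_mul_sum, ← sq, Finset.sum_sub_distrib]
    simp [sq]
  rw [e]
  refine ⟨integrable_finsetSum _ fun i _ => integrable_finsetSum _ fun j _ => (key i j).1, ?_⟩
  rw [integral_finsetSum _ fun i _ => integrable_finsetSum _ fun j _ => (key i j).1]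
  simp_rw [integral_finsetSum _ fun j _ => (key _ j).1, (key _ _).2]
  simp [mul_comm]

end GaussianVector

section SpectralBound

lemma integrableOn_one_sub_cos_mul_rpow {H : ℝ} (hH : H ∈ Set.Ioo (0 : ℝ) 1) (x : ℝ) :
    IntegrableOn (fun l : ℝ => (1 - Real.cos (x * l)) * l ^ (-1 - 2 * H)) (Set.Ioi 0) := by
  obtain ⟨h0, h1⟩ := hH
  have hmeas : Measurable (fun l : ℝ => (1 - Real.cos (x * l)) * l ^ (-1 - 2 * H)) := by fun_prop
  rw [← Set.Ioc_union_Ioi_eq_Ioi (zero_le_one' ℝ)]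
  refine IntegrableOn.union ?_ ?_
  · have hinteg : IntegrableOn (fun l : ℝ => x ^ 2 / 2 * l ^ (1 - 2 * H)) (Set.Ioc 0 1) := by
      have := (intervalIntegral.intervalIntegrable_rpow' (a := 0) (b := 1)
        (by linarith : -1 < 1 - 2 * H)).const_mul (x ^ 2 / 2)
      exact (intervalIntegrable_iff_integrableOn_Ioc_of_le zero_le_one).1 this
    refine Integrable.mono' hinteg hmeas.aestronglyMeasurable ?_
    refine (ae_restrict_iff' measurableSet_Ioc).2 (Eventually.of_forall fun l hl => ?_)
    have hl0 : 0 < l := hl.1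
    have hc := Real.one_sub_sq_div_two_le_cos (x := x * l)
    have hc' := Real.cos_le_one (x * l)
    have hp : 0 ≤ l ^ (-1 - 2 * H) := Real.rpow_nonneg hl0.le _
    rw [Real.norm_of_nonneg (mul_nonneg (by linarith) hp)]
    have e : l ^ (1 - 2 * H) = l ^ 2 * l ^ (-1 - 2 * H) := by
      rw [← Real.rpow_natCast, ← Real.rpow_add hl0]; congr 1; push_cast; ring
    rw [e]
    calc _ ≤ ((x * l) ^ 2 / 2) * l ^ (-1 - 2 * H) :=
          mul_le_mul_of_nonneg_right (by linarith) hp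
      _ = _ := by ring
  · have hinteg : IntegrableOn (fun l : ℝ => 2 * l ^ (-1 - 2 * H)) (Set.Ioi 1) :=
      (integrableOn_Ioi_rpow_of_lt (by linarith) zero_lt_one).const_mul 2
    refine Integrable.mono' hinteg hmeas.aestronglyMeasurable ?_
    refine (ae_restrict_iff' measurableSet_Ioi).2 (Eventually.of_forall fun l hl => ?_)
    have hl0 : 0 < l := zero_lt_one.trans hl
    have hc := Real.neg_one_le_cos (x * l)
    have hc' := Real.cos_le_one (x * l)
    have hp : 0 ≤ l ^ (-1 - 2 * H) := Real.rpow_nonneg hl0.le _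
    rw [Real.norm_of_nonneg (mul_nonneg (by linarith) hp)]
    exact mul_le_mul_of_nonneg_right (by linarith) hp

/-- The normalizing constant `∫₀^∞ (1 - cos l) l ^ (-1 - 2 * H) dl` of the spectral representation
of fractional Brownian motion. -/
def fbmSpecConst (H : ℝ) : ℝ := ∫ l in Set.Ioi (0 : ℝ), (1 - Real.cos (1 * l)) * l ^ (-1 - 2 * H)

lemma integral_one_sub_cos_mul_rpow {H : ℝ} (hH : H ∈ Set.Ioo (0 : ℝ) 1) (x : ℝ) :
    ∫ l in Set.Ioi (0 : ℝ), (1 - Real.cos (x * l)) * l ^ (-1 - 2 * H) =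
      fbmSpecConst H * |x| ^ (2 * H) := by
  obtain ⟨h0, h1⟩ := hH
  rcases eq_or_ne x 0 with rfl | hx
  · have : 2 * H ≠ 0 := by positivity
    simp [Real.zero_rpow this]
  have hx' : 0 < |x| := abs_pos.2 hx
  have h := integral_comp_mul_left_Ioi
    (fun l : ℝ => (1 - Real.cos (1 * l)) * l ^ (-1 - 2 * H)) 0 hx'
  rw [mul_zero] at h
  have e : ∫ l in Set.Ioi (0 : ℝ), (1 - Real.cos (x * l)) * l ^ (-1 - 2 * H) =
      ∫ l in Set.Ioi (0 : ℝ), |x| ^ (1 + 2 * H) *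
        ((1 - Real.cos (1 * (|x| * l))) * (|x| * l) ^ (-1 - 2 * H)) := by
    refine setIntegral_congr_fun measurableSet_Ioi fun l hl => ?_
    have hl0 : 0 < l := hl
    have e1 : Real.cos (1 * (|x| * l)) = Real.cos (x * l) := by
      rw [one_mul, ← Real.cos_abs (x * l), abs_mul, abs_of_pos hl0]
    have e2 : |x| ^ (1 + 2 * H) * |x| ^ (-1 - 2 * H) = 1 := by
      rw [← Real.rpow_add hx', show (1 + 2 * H) + (-1 - 2 * H) = 0 by ring, Real.rpow_zero]
    rw [e1, Real.mul_rpow hx'.le hl0.le]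
    linear_combination -(1 - Real.cos (x * l)) * l ^ (-1 - 2 * H) * e2
  rw [e, integral_const_mul, h, smul_eq_mul, fbmSpecConst]
  have e3 : |x| ^ (1 + 2 * H) * |x|⁻¹ = |x| ^ (2 * H) := by
    rw [Real.rpow_add hx', Real.rpow_one]; field_simp
  rw [← mul_assoc, e3, mul_comm]

variable {N : ℕ}

/-- Squared modulus of the trigonometric polynomial with coefficients `b`. -/
def trigSq (b : Fin N → ℝ) (l : ℝ) : ℝ :=
  (∑ i, b i * Real.cos ((i : ℝ) * l)) ^ 2 + (∑ i, b i * Real.sin ((i : ℝ) * l)) ^ 2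

lemma trigSq_nonneg (b : Fin N → ℝ) (l : ℝ) : 0 ≤ trigSq b l := by unfold trigSq; positivity

lemma continuous_trigSq (b : Fin N → ℝ) : Continuous (trigSq b) := by unfold trigSq; fun_prop

lemma trigSq_eq_sum (b : Fin N → ℝ) (l : ℝ) :
    trigSq b l = ∑ i : Fin N, ∑ j : Fin N, b i * b j * Real.cos (((i : ℝ) - j) * l) := by
  unfold trigSq
  rw [sq, sq, Finset.sum_mul_sum, Finset.sum_mul_sum, ← Finset.sum_add_distrib]
  refine Finset.sum_congr rfl fun i _ => ?_
  rw [← Finset.sum_add_distrib]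
  refine Finset.sum_congr rfl fun j _ => ?_
  rw [sub_mul, Real.cos_sub]; ring

lemma trigSq_le (b : Fin N → ℝ) (l : ℝ) : trigSq b l ≤ N * (b ⬝ᵥ b) := by
  unfold trigSq
  have h1 := Finset.sum_mul_sq_le_sq_mul_sq Finset.univ b fun i : Fin N => Real.cos ((i : ℝ) * l)
  have h2 := Finset.sum_mul_sq_le_sq_mul_sq Finset.univ b fun i : Fin N => Real.sin ((i : ℝ) * l)
  have e : b ⬝ᵥ b = ∑ i, b i ^ 2 := by simp [dotProduct, sq]
  have e2 : (∑ i : Fin N, Real.cos ((i : ℝ) * l) ^ 2) + ∑ i : Fin N, Real.sin ((i : ℝ) * l) ^ 2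
      = N := by
    rw [← Finset.sum_add_distrib]; simp
  rw [e, ← e2]
  linarith

lemma integral_trigSq (b : Fin N → ℝ) :
    ∫ l in (0 : ℝ)..Real.pi, trigSq b l = Real.pi * (b ⬝ᵥ b) := by
  simp_rw [trigSq_eq_sum]
  have hii : ∀ i j : Fin N, IntervalIntegrable
      (fun l => b i * b j * Real.cos (((i : ℝ) - j) * l)) volume 0 Real.pi :=
    fun i j => Continuous.intervalIntegrable (by fun_prop) _ _
  rw [intervalIntegral.integral_finsetSum fun i _ =>
    Continuous.intervalIntegrable (by fun_prop) _ _]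
  simp_rw [intervalIntegral.integral_finsetSum fun j _ => hii _ j]
  have h : ∀ i j : Fin N, ∫ l in (0 : ℝ)..Real.pi, b i * b j * Real.cos (((i : ℝ) - j) * l) =
      if i = j then Real.pi * (b i * b j) else 0 := by
    intro i j
    split_ifs with hij
    · subst hij; simp; ring
    · have hne : ((i : ℝ) - j) ≠ 0 := by
        rw [sub_ne_zero]
        exact fun h => hij (Fin.ext (by exact_mod_cast h))
      rw [intervalIntegral.integral_const_mul, intervalIntegral.integral_comp_mul_left _ hne,
        integral_cos]
      have : ((i : ℝ) - j) * Real.pi = (((i : ℤ) - (j : ℤ) : ℤ) : ℝ) * Real.pi := by push_cast; rfl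
      rw [this, Real.sin_int_mul_pi]
      simp
  simp_rw [h]
  simp [dotProduct, Finset.mul_sum]

lemma dotProduct_self_le_integral_trigSq (hN : 0 < N) (b : Fin N → ℝ) :
    b ⬝ᵥ b ≤ ∫ l in (1 / (N : ℝ))..Real.pi, trigSq b l := by
  have hN' : (0 : ℝ) < N := by exact_mod_cast hN
  have hii : ∀ u v : ℝ, IntervalIntegrable (trigSq b) volume u v :=
    fun u v => (continuous_trigSq b).intervalIntegrable _ _
  have h1 := intervalIntegral.integral_add_adjacent_intervals (hii 0 (1 / (N : ℝ)))
    (hii (1 / (N : ℝ)) Real.pi)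
  have h2 : ∫ l in (0 : ℝ)..(1 / (N : ℝ)), trigSq b l ≤ ∫ l in (0 : ℝ)..(1 / (N : ℝ)),
      N * (b ⬝ᵥ b) :=
    intervalIntegral.integral_mono (by positivity) (hii _ _)
      (Continuous.intervalIntegrable (by fun_prop) _ _) fun l => trigSq_le b l
  rw [intervalIntegral.integral_const, smul_eq_mul, sub_zero, ← mul_assoc,
    one_div_mul_cancel hN'.ne', one_mul] at h2
  rw [integral_trigSq] at h1
  have h3 : 0 ≤ b ⬝ᵥ b := Finset.sum_nonneg fun i _ => mul_self_nonneg _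
  nlinarith [Real.pi_gt_three]

/-- Spectral representation of the covariance form of the increments of fractional Brownian
motion. -/
lemma spectral_form {H : ℝ} (hH : H ∈ Set.Ioo (0 : ℝ) 1) (b : Fin N → ℝ) :
    IntegrableOn (fun l => 2 * (1 - Real.cos l) * trigSq b l * l ^ (-1 - 2 * H)) (Set.Ioi 0) ∧
    ∫ l in Set.Ioi (0 : ℝ), 2 * (1 - Real.cos l) * trigSq b l * l ^ (-1 - 2 * H) =
    fbmSpecConst H * ∑ i : Fin N, ∑ j : Fin N, b i * b j * (|(i : ℝ) - (j : ℝ) + 1| ^ (2 * H)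
      + |(i : ℝ) - (j : ℝ) - 1| ^ (2 * H) - 2 * |(i : ℝ) - (j : ℝ)| ^ (2 * H)) := by
  set g : ℝ → ℝ → ℝ := fun x l => (1 - Real.cos (x * l)) * l ^ (-1 - 2 * H) with hg
  have hgi : ∀ x, IntegrableOn (g x) (Set.Ioi 0) := integrableOn_one_sub_cos_mul_rpow hH
  have hgv : ∀ x, ∫ l in Set.Ioi (0 : ℝ), g x l = fbmSpecConst H * |x| ^ (2 * H) :=
    integral_one_sub_cos_mul_rpow hH
  have e : (fun l => 2 * (1 - Real.cos l) * trigSq b l * l ^ (-1 - 2 * H)) = fun l =>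
      ∑ i : Fin N, ∑ j : Fin N, b i * b j * (g ((i : ℝ) - j + 1) l + g ((i : ℝ) - j - 1) l
        - 2 * g ((i : ℝ) - j) l) := by
    ext l
    rw [trigSq_eq_sum, Finset.mul_sum, Finset.sum_mul]
    refine Finset.sum_congr rfl fun i _ => ?_
    rw [Finset.mul_sum, Finset.sum_mul]
    refine Finset.sum_congr rfl fun j _ => ?_
    simp only [hg, add_mul, sub_mul _ (1 : ℝ) l, one_mul]
    rw [Real.cos_add, Real.cos_sub _ l]
    ring
  have hI1 : ∀ x, IntegrableOn (fun l => g (x + 1) l + g (x - 1) l) (Set.Ioi 0) :=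
    fun x => (hgi _).add (hgi _)
  have hI : ∀ x, IntegrableOn (fun l => g (x + 1) l + g (x - 1) l - 2 * g x l) (Set.Ioi 0) :=
    fun x => (hI1 x).sub ((hgi _).const_mul 2)
  have hi : ∀ i j : Fin N, IntegrableOn (fun l => b i * b j * (g ((i : ℝ) - j + 1) l +
      g ((i : ℝ) - j - 1) l - 2 * g ((i : ℝ) - j) l)) (Set.Ioi 0) :=
    fun i j => (hI _).const_mul _
  rw [e]
  refine ⟨integrable_finsetSum _ fun i _ => integrable_finsetSum _ fun j _ => hi i j, ?_⟩
  rw [integral_finsetSum _ fun i _ => integrable_finsetSum _ fun j _ => hi i j, Finset.mul_sum]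
  refine Finset.sum_congr rfl fun i _ => ?_
  rw [integral_finsetSum _ fun j _ => hi i j, Finset.mul_sum]
  refine Finset.sum_congr rfl fun j _ => ?_
  rw [integral_const_mul, integral_sub (hI1 _) ((hgi _).const_mul 2),
    integral_add (hgi _) (hgi _), integral_const_mul, hgv, hgv, hgv]
  ring

lemma le_spectral_form {H : ℝ} (hH : H ∈ Set.Ioo (0 : ℝ) 1) (hN : 0 < N) (b : Fin N → ℝ) :
    4 / Real.pi ^ 3 * (N : ℝ) ^ (-max 0 (1 - 2 * H)) * (b ⬝ᵥ b) ≤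
    fbmSpecConst H * ∑ i : Fin N, ∑ j : Fin N, b i * b j * (|(i : ℝ) - (j : ℝ) + 1| ^ (2 * H)
      + |(i : ℝ) - (j : ℝ) - 1| ^ (2 * H) - 2 * |(i : ℝ) - (j : ℝ)| ^ (2 * H)) := by
  have hN' : (0 : ℝ) < N := by exact_mod_cast hN
  have hN1 : (1 : ℝ) ≤ N := by exact_mod_cast hN
  have hpi := Real.pi_gt_three
  have hle : 1 / (N : ℝ) ≤ Real.pi := by
    have : 1 / (N : ℝ) ≤ 1 := (div_le_one hN').2 hN1
    linarith
  obtain ⟨hinteg, hval⟩ := spectral_form hH b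
  rw [← hval]
  have hsub : Set.Ioc (1 / (N : ℝ)) Real.pi ⊆ Set.Ioi 0 :=
    fun l hl => lt_trans (by positivity) hl.1
  set K := 4 / Real.pi ^ 3 * (N : ℝ) ^ (-max 0 (1 - 2 * H)) with hK
  have hK0 : 0 ≤ K := by positivity
  calc K * (b ⬝ᵥ b) ≤ K * ∫ l in (1 / (N : ℝ))..Real.pi, trigSq b l :=
        mul_le_mul_of_nonneg_left (dotProduct_self_le_integral_trigSq hN b) hK0
    _ = ∫ l in Set.Ioc (1 / (N : ℝ)) Real.pi, K * trigSq b l := by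
        rw [integral_const_mul, intervalIntegral.integral_of_le hle]
    _ ≤ ∫ l in Set.Ioc (1 / (N : ℝ)) Real.pi,
          2 * (1 - Real.cos l) * trigSq b l * l ^ (-1 - 2 * H) := by
        refine setIntegral_mono_on ?_ (hinteg.mono_set hsub) measurableSet_Ioc fun l hl => ?_
        · exact ((continuous_const.mul (continuous_trigSq b)).integrableOn_Icc).mono_set
            Set.Ioc_subset_Icc_self
        · have hl0 : 0 < l := hsub hl
          have hcos := Real.cos_le_one_sub_mul_cos_sq (x := l)
            (by rw [abs_of_pos hl0]; exact hl.2)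
          have hrp : Real.pi⁻¹ * (N : ℝ) ^ (-max 0 (1 - 2 * H)) ≤ l ^ (1 - 2 * H) := by
            rcases le_total 0 (1 - 2 * H) with h | h
            · rw [max_eq_right h, Real.rpow_neg hN'.le, ← Real.inv_rpow hN'.le]
              have h1 : (N : ℝ)⁻¹ ^ (1 - 2 * H) ≤ l ^ (1 - 2 * H) :=
                Real.rpow_le_rpow (by positivity) (by rw [← one_div]; exact hl.1.le) h
              have h2 : Real.pi⁻¹ ≤ 1 := inv_le_one_of_one_le₀ (by linarith)
              have h3 : 0 ≤ (N : ℝ)⁻¹ ^ (1 - 2 * H) := by positivity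
              nlinarith
            · rw [max_eq_left h, neg_zero, Real.rpow_zero, mul_one]
              calc Real.pi⁻¹ = Real.pi ^ (-1 : ℝ) := (Real.rpow_neg_one _).symm
                _ ≤ Real.pi ^ (1 - 2 * H) :=
                  Real.rpow_le_rpow_of_exponent_le (by linarith) (by linarith [hH.2])
                _ ≤ l ^ (1 - 2 * H) := Real.rpow_le_rpow_of_nonpos hl0 hl.2 h
          have hp : 0 ≤ l ^ (-1 - 2 * H) := Real.rpow_nonneg hl0.le _
          have e : l ^ (1 - 2 * H) = l ^ 2 * l ^ (-1 - 2 * H) := by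
            rw [← Real.rpow_natCast, ← Real.rpow_add hl0]; congr 1; push_cast; ring
          calc K * trigSq b l
              = 4 / Real.pi ^ 2 * (Real.pi⁻¹ * (N : ℝ) ^ (-max 0 (1 - 2 * H))) * trigSq b l := by
                rw [hK]; field_simp
            _ ≤ 4 / Real.pi ^ 2 * l ^ (1 - 2 * H) * trigSq b l := by
                gcongr
                exact trigSq_nonneg b l
            _ = 2 * (2 / Real.pi ^ 2 * l ^ 2) * trigSq b l * l ^ (-1 - 2 * H) := by rw [e]; ring
            _ ≤ _ := by
                have := trigSq_nonneg b l
                gcongr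
                linarith
    _ ≤ _ := by
        refine setIntegral_mono_set hinteg ?_ (LE.le.eventuallyLE hsub)
        refine (ae_restrict_iff' measurableSet_Ioi).2 (Eventually.of_forall fun l hl => ?_)
        have hl0 : 0 < l := hl
        have h1 := Real.cos_le_one l
        have h2 := trigSq_nonneg b l
        have : 0 ≤ 1 - Real.cos l := by linarith
        simp only [Pi.zero_apply]
        positivity

lemma fbmSpecConst_pos {H : ℝ} (hH : H ∈ Set.Ioo (0 : ℝ) 1) : 0 < fbmSpecConst H := by
  have h := le_spectral_form hH zero_lt_one (fun _ : Fin 1 => 1)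
  have : 2 * H ≠ 0 := by linarith [hH.1]
  simp [Real.zero_rpow this, dotProduct] at h
  have h2 : 0 < 4 / Real.pi ^ 3 := by positivity
  linarith

/-- Lower bound on the smallest eigenvalue of the covariance matrix of the increments of
fractional Brownian motion. -/
lemma SigmaH_lower_bound {H : ℝ} (hH : H ∈ Set.Ioo (0 : ℝ) 1) :
    ∃ κ : ℝ, 0 < κ ∧ ∀ (N : ℕ) (δ : ℝ), 0 < N → 0 < δ → ∀ b : Fin N → ℝ,
      κ * δ ^ (2 * H) * (N : ℝ) ^ (-max 0 (1 - 2 * H)) * (b ⬝ᵥ b) ≤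
        b ⬝ᵥ (SigmaH H δ N *ᵥ b) := by
  have hc := fbmSpecConst_pos hH
  refine ⟨(fbmSpecConst H)⁻¹ * (2 / Real.pi ^ 3), by positivity, fun N δ hN hδ b => ?_⟩
  have h := le_spectral_form hH hN b
  have e : b ⬝ᵥ (SigmaH H δ N *ᵥ b) = δ ^ (2 * H) / 2 * ∑ i : Fin N, ∑ j : Fin N, b i * b j *
      (|(i : ℝ) - (j : ℝ) + 1| ^ (2 * H)
      + |(i : ℝ) - (j : ℝ) - 1| ^ (2 * H) - 2 * |(i : ℝ) - (j : ℝ)| ^ (2 * H)) := by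
    simp only [dotProduct, mulVec, SigmaH, Finset.mul_sum]
    refine Finset.sum_congr rfl fun i _ => Finset.sum_congr rfl fun j _ => ?_
    ring
  rw [e]
  have h2 : 0 ≤ δ ^ (2 * H) / 2 * (fbmSpecConst H)⁻¹ := by positivity
  have h3 := mul_le_mul_of_nonneg_left h h2
  rw [mul_assoc _ _ (fbmSpecConst H * _), inv_mul_cancel_left₀ hc.ne'] at h3
  refine le_trans (le_of_eq ?_) h3
  ring

end SpectralBound

section FBM

variable {Ω : Type*} [MeasureSpace Ω] {H : ℝ} {B : ℝ → Ω → ℝ}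

lemma IsTwoSidedFBM.map_sum (hB : IsTwoSidedFBM H B) {ι : Type*} [Fintype ι] (t a : ι → ℝ) :
    Measure.map (fun ω => ∑ i, a i * B (t i) ω) (ℙ : Measure Ω)
      = gaussianReal 0 (∑ i, ∑ j, a i * a j * fbmCov H (t i) (t j)).toNNReal := by
  have h := hB.gaussian (Fintype.card ι) (t ∘ (Fintype.equivFin ι).symm)
    (a ∘ (Fintype.equivFin ι).symm)
  simp only [Function.comp] at h
  have e1 : ∀ ω, ∑ i, a ((Fintype.equivFin ι).symm i) * B (t ((Fintype.equivFin ι).symm i)) ω =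
      ∑ i, a i * B (t i) ω := fun ω =>
    Equiv.sum_comp (Fintype.equivFin ι).symm fun i => a i * B (t i) ω
  simp_rw [e1] at h
  rw [h]
  congr 2
  rw [← Equiv.sum_comp (Fintype.equivFin ι).symm]
  refine Finset.sum_congr rfl fun i _ => ?_
  rw [← Equiv.sum_comp (Fintype.equivFin ι).symm]

lemma fbmCov_increment (H : ℝ) (s t u v : ℝ) :
    fbmCov H s u - fbmCov H s v - fbmCov H t u + fbmCov H t v =
      (|s - v| ^ (2 * H) + |t - u| ^ (2 * H) - |s - u| ^ (2 * H) - |t - v| ^ (2 * H)) / 2 := by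
  unfold fbmCov; ring

/-- Law of linear combinations of increments of fractional Brownian motion. -/
lemma IsTwoSidedFBM.map_sum_sub (hB : IsTwoSidedFBM H B) {ι : Type*} [Fintype ι]
    (s t a : ι → ℝ) :
    Measure.map (fun ω => ∑ i, a i * (B (t i) ω - B (s i) ω)) (ℙ : Measure Ω)
      = gaussianReal 0 (∑ i, ∑ j, a i * a j *
        ((|t i - s j| ^ (2 * H) + |s i - t j| ^ (2 * H) - |t i - t j| ^ (2 * H)
          - |s i - s j| ^ (2 * H)) / 2)).toNNReal := by
  have h := hB.map_sum (Sum.elim t s) (Sum.elim a fun i => -a i)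
  simp only [Fintype.sum_sum_type, Sum.elim_inl, Sum.elim_inr] at h
  have e1 : ∀ ω, ∑ i, a i * (B (t i) ω - B (s i) ω) =
      ∑ i, a i * B (t i) ω + ∑ i, -a i * B (s i) ω := fun ω => by
    rw [← Finset.sum_add_distrib]
    exact Finset.sum_congr rfl fun i _ => by ring
  simp_rw [e1]
  rw [h]
  congr 2
  simp only [← Finset.sum_add_distrib]
  refine Finset.sum_congr rfl fun i _ => Finset.sum_congr rfl fun j _ => ?_
  rw [← fbmCov_increment]
  ring

lemma IsTwoSidedFBM.map_sub (hB : IsTwoSidedFBM H B) (hH : 0 < H) (s t : ℝ) :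
    Measure.map (fun ω => B t ω - B s ω) (ℙ : Measure Ω)
      = gaussianReal 0 (|t - s| ^ (2 * H)).toNNReal := by
  have h := hB.map_sum_sub (ι := Unit) (fun _ => s) (fun _ => t) (fun _ => 1)
  have h0 : 2 * H ≠ 0 := by positivity
  simp only [Finset.univ_unique, Finset.sum_singleton, one_mul, sub_self, abs_zero,
    Real.zero_rpow h0, abs_sub_comm s t] at h
  rw [h]
  congr 2
  ring

/-- The increments over a grid form a Gaussian vector with covariance matrix `SigmaH`. -/
lemma IsTwoSidedFBM.map_grid (hB : IsTwoSidedFBM H B) {δ : ℝ} (hδ : 0 < δ) {N : ℕ}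
    (a : Fin N → ℝ) :
    Measure.map (fun ω => ∑ i : Fin N, a i * (B (((i : ℕ) + 1 : ℝ) * δ) ω - B ((i : ℕ) * δ) ω))
      (ℙ : Measure Ω) = gaussianReal 0 (a ⬝ᵥ (SigmaH H δ N *ᵥ a)).toNNReal := by
  rw [hB.map_sum_sub (fun i : Fin N => ((i : ℕ) : ℝ) * δ) (fun i : Fin N => ((i : ℕ) + 1 : ℝ) * δ)]
  congr 2
  have hm : ∀ x : ℝ, |x * δ| ^ (2 * H) = |x| ^ (2 * H) * δ ^ (2 * H) := fun x => by
    rw [abs_mul, abs_of_pos hδ, Real.mul_rpow (abs_nonneg _) hδ.le]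
  simp only [dotProduct, mulVec, SigmaH, Finset.mul_sum]
  refine Finset.sum_congr rfl fun i _ => Finset.sum_congr rfl fun j _ => ?_
  rw [show ((i : ℕ) + 1 : ℝ) * δ - (j : ℕ) * δ = ((i : ℝ) - j + 1) * δ by ring,
    show ((i : ℕ) : ℝ) * δ - ((j : ℕ) + 1 : ℝ) * δ = ((i : ℝ) - j - 1) * δ by ring,
    show ((i : ℕ) + 1 : ℝ) * δ - ((j : ℕ) + 1 : ℝ) * δ = ((i : ℝ) - j) * δ by ring,
    show ((i : ℕ) : ℝ) * δ - ((j : ℕ) : ℝ) * δ = ((i : ℝ) - j) * δ by ring, hm, hm, hm]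
  ring

lemma SigmaH_isSymm (H δ : ℝ) (N : ℕ) : (SigmaH H δ N).IsSymm := by
  ext i j
  simp only [transpose_apply, SigmaH]
  rw [abs_sub_comm (j : ℝ) i, show |(j : ℝ) - i + 1| = |(i : ℝ) - j - 1| by
    rw [← abs_neg]; congr 1; ring, show |(j : ℝ) - i - 1| = |(i : ℝ) - j + 1| by
    rw [← abs_neg]; congr 1; ring]
  ring

/-- Second centered moment of the squared norm of the whitened increment vector. -/
lemma IsTwoSidedFBM.chiSq [IsProbabilityMeasure (ℙ : Measure Ω)] (hB : IsTwoSidedFBM H B) {δ : ℝ}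
    (hδ : 0 < δ) {N : ℕ} {A : Matrix (Fin N) (Fin N) ℝ} (hA : A * SigmaH H δ N * Aᵀ = 1) :
    let U : Ω → Fin N → ℝ := fun ω k => B (((k : ℕ) + 1 : ℝ) * δ) ω - B ((k : ℕ) * δ) ω
    Integrable (fun ω => ((A *ᵥ U ω) ⬝ᵥ (A *ᵥ U ω) - N) ^ 2) ∧
      ∫ ω, ((A *ᵥ U ω) ⬝ᵥ (A *ᵥ U ω) - N) ^ 2 = 2 * N := by
  intro U
  have hm := hB.meas
  refine integral_chiSq_sub_sq (P := (ℙ : Measure Ω)) (Z := fun i ω => (A *ᵥ U ω) i) ?_ ?_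
  · intro i
    simp only [mulVec, dotProduct, U]
    fun_prop
  · intro a
    have h := hB.map_grid hδ (a ᵥ* A)
    have e1 : ∀ ω, ∑ i : Fin N, (a ᵥ* A) i * (B (((i : ℕ) + 1 : ℝ) * δ) ω - B ((i : ℕ) * δ) ω) =
        ∑ i, a i * (A *ᵥ U ω) i := fun ω => (dotProduct_mulVec a A (U ω)).symm
    simp_rw [e1] at h
    rw [h]
    congr 2
    rw [← dotProduct_mulVec, ← mulVec_transpose, mulVec_mulVec, mulVec_mulVec, hA, one_mulVec]
    rfl

end FBM

section OrnsteinUhlenbeck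

/-- Moments of the exponential kernel with time scale `ε`. -/
lemma expKernel_moment {ε q : ℝ} (hε : 0 < ε) (hq : 0 ≤ q) (t : ℝ) :
    IntegrableOn (fun s => 1 / ε * Real.exp (-(t - s) / ε) * |t - s| ^ q) (Set.Iic t) ∧
      ∫ s in Set.Iic t, 1 / ε * Real.exp (-(t - s) / ε) * |t - s| ^ q =
        Real.Gamma (q + 1) * ε ^ q := by
  set φ : ℝ → ℝ := (Set.Ici 0).indicator fun u => 1 / ε * Real.exp (-u / ε) * |u| ^ q with hφ
  have hcomp : (fun s => φ (t - s)) = (Set.Iic t).indicator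
      fun s => 1 / ε * Real.exp (-(t - s) / ε) * |t - s| ^ q := by
    ext s
    by_cases hs : s ≤ t
    · rw [hφ, Set.indicator_of_mem (show t - s ∈ Set.Ici 0 from sub_nonneg.2 hs),
        Set.indicator_of_mem (show s ∈ Set.Iic t from hs)]
    · rw [hφ, Set.indicator_of_notMem (show t - s ∉ Set.Ici 0 from fun h => hs (sub_nonneg.1 h)),
        Set.indicator_of_notMem (show s ∉ Set.Iic t from hs)]
  have hEq : Set.EqOn (fun u => 1 / ε * (u ^ (q + 1 - 1) * Real.exp (-(1 / ε * u))))
      (fun u => 1 / ε * Real.exp (-u / ε) * |u| ^ q) (Set.Ioi 0) := by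
    intro u hu
    have hu0 : 0 < u := hu
    simp only []
    rw [abs_of_pos hu0, add_sub_cancel_right, show -(1 / ε * u) = -u / ε by ring]
    ring
  have hinteg : Integrable φ := by
    rw [hφ, integrable_indicator_iff measurableSet_Ici, integrableOn_Ici_iff_integrableOn_Ioi]
    refine IntegrableOn.congr_fun ?_ hEq measurableSet_Ioi
    refine Integrable.const_mul ?_ _
    have := integrableOn_rpow_mul_exp_neg_mul_rpow (p := 1) (s := q + 1 - 1) (b := 1 / ε)
      (by linarith) one_pos (by positivity)
    simpa [IntegrableOn] using this
  have hval : ∫ u, φ u = Real.Gamma (q + 1) * ε ^ q := by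
    rw [hφ, integral_indicator measurableSet_Ici, integral_Ici_eq_integral_Ioi,
      ← setIntegral_congr_fun measurableSet_Ioi hEq, integral_const_mul,
      Real.integral_rpow_mul_exp_neg_mul_Ioi (by linarith) (by positivity), one_div_one_div,
      Real.rpow_add hε, Real.rpow_one]
    field_simp
  constructor
  · rw [← integrable_indicator_iff measurableSet_Iic, ← hcomp]
    exact hinteg.comp_sub_left t
  · rw [← integral_indicator measurableSet_Iic, ← hcomp, integral_sub_left_eq_self φ, hval]

lemma expKernel_integral {ε : ℝ} (hε : 0 < ε) (t : ℝ) :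
    IntegrableOn (fun s => 1 / ε * Real.exp (-(t - s) / ε)) (Set.Iic t) ∧
      ∫ s in Set.Iic t, 1 / ε * Real.exp (-(t - s) / ε) = 1 := by
  simpa using expKernel_moment hε le_rfl t

/-- Jensen's inequality for the fourth power against a probability density. -/
lemma pow_four_integral_le {α : Type*} [MeasurableSpace α] {μ : Measure α} {k f : α → ℝ}
    (hk0 : ∀ x, 0 ≤ k x) (hk : Integrable k μ) (hk1 : ∫ x, k x ∂μ = 1)
    (hf : Integrable (fun x => k x * f x) μ) (hf4 : Integrable (fun x => k x * f x ^ 4) μ) :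
    (∫ x, k x * f x ∂μ) ^ 4 ≤ ∫ x, k x * f x ^ 4 ∂μ := by
  set m := ∫ x, k x * f x ∂μ with hm
  have h1 : ∫ x, (4 * m ^ 3 * (k x * f x) - 3 * m ^ 4 * k x) ∂μ ≤ ∫ x, k x * f x ^ 4 ∂μ := by
    refine integral_mono ((hf.const_mul _).sub (hk.const_mul _)) hf4 fun x => ?_
    have : 4 * m ^ 3 * f x - 3 * m ^ 4 ≤ f x ^ 4 := by
      nlinarith [sq_nonneg (f x ^ 2 - m ^ 2), sq_nonneg (m * (f x - m)),
        sq_nonneg (f x * (f x - m)), sq_nonneg ((f x - m) * (f x + m))]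
    have := mul_le_mul_of_nonneg_left this (hk0 x)
    simp only []
    linarith
  rw [integral_sub (hf.const_mul _) (hk.const_mul _), integral_const_mul, integral_const_mul, hk1,
    ← hm] at h1
  linarith

/-- Convolution of a path with the exponential kernel. -/
def expConv (ε : ℝ) (f : ℝ → ℝ) (t : ℝ) : ℝ := ∫ s in Set.Iic t, Real.exp (-(t - s) / ε) * f s

lemma hasDerivAt_expConv {ε : ℝ} {f : ℝ → ℝ} (hf : Continuous f)
    (hinteg : ∀ t, IntegrableOn (fun s => Real.exp (-(t - s) / ε) * f s) (Set.Iic t)) (t : ℝ) :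
    HasDerivAt (expConv ε f) (f t - 1 / ε * expConv ε f t) t := by
  set g : ℝ → ℝ := fun s => Real.exp (s / ε) * f s with hg
  have hgc : Continuous g := by fun_prop
  have hfac : ∀ t s, Real.exp (-(t - s) / ε) * f s = Real.exp (-t / ε) * g s := fun t s => by
    rw [hg, ← mul_assoc, ← Real.exp_add]; congr 2; ring
  have hconv : ∀ t, expConv ε f t = Real.exp (-t / ε) * ∫ s in Set.Iic t, g s := fun t => by
    simp_rw [expConv, hfac]
    rw [integral_const_mul]
  have hgi : ∀ t, IntegrableOn g (Set.Iic t) := fun t => by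
    have h := (hinteg t).const_mul (Real.exp (t / ε))
    refine h.congr (Eventually.of_forall fun s => ?_)
    simp only []
    rw [hfac, ← mul_assoc, ← Real.exp_add, show t / ε + -t / ε = 0 by ring, Real.exp_zero, one_mul]
  have hJ : HasDerivAt (fun t => ∫ s in Set.Iic t, g s) (g t) t := by
    have e : (fun t => ∫ s in Set.Iic t, g s) =
        fun t => (∫ s in Set.Iic (0 : ℝ), g s) + ∫ s in (0 : ℝ)..t, g s := by
      ext u
      rw [← intervalIntegral.integral_Iic_sub_Iic (hgi 0) (hgi u)]; ring
    rw [e]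
    exact (intervalIntegral.integral_hasDerivAt_right (hgc.intervalIntegrable _ _)
      (hgc.stronglyMeasurableAtFilter _ _) hgc.continuousAt).const_add _
  have hE : HasDerivAt (fun t => Real.exp (-t / ε)) (Real.exp (-t / ε) * (-1 / ε)) t :=
    ((hasDerivAt_id t).neg.div_const ε).exp
  have h := hE.fun_mul hJ
  rw [funext hconv]
  refine h.congr_deriv ?_
  have : Real.exp (-t / ε) * g t = f t := by
    rw [← hfac]; simp
  rw [this]
  ring

lemma integral_sub_expConv {ε : ℝ} {f : ℝ → ℝ} (hf : Continuous f)
    (hinteg : ∀ t, IntegrableOn (fun s => Real.exp (-(t - s) / ε) * f s) (Set.Iic t)) (a b : ℝ) :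
    ∫ s in a..b, (f s - 1 / ε * expConv ε f s) = expConv ε f b - expConv ε f a := by
  have hd := hasDerivAt_expConv hf hinteg
  have hc : Continuous (expConv ε f) :=
    continuous_iff_continuousAt.2 fun t => (hd t).continuousAt
  exact intervalIntegral.integral_eq_sub_of_hasDerivAt (fun t _ => hd t)
    (Continuous.intervalIntegrable (by fun_prop) _ _)

variable {Ω : Type*} {B : ℝ → Ω → ℝ}

/-- The fractional Ornstein–Uhlenbeck process normalized to be driven by unscaled noise. -/
def unitOU (ε : ℝ) (B : ℝ → Ω → ℝ) (t : ℝ) (ω : Ω) : ℝ :=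
  B t ω - 1 / ε * expConv ε (fun s => B s ω) t

lemma unitOU_eq {ε : ℝ} (hε : 0 < ε) {ω : Ω} {t : ℝ}
    (hinteg : IntegrableOn (fun s => Real.exp (-(t - s) / ε) * B s ω) (Set.Iic t)) :
    IntegrableOn (fun s => 1 / ε * Real.exp (-(t - s) / ε) * (B t ω - B s ω)) (Set.Iic t) ∧
    unitOU ε B t ω = ∫ s in Set.Iic t, 1 / ε * Real.exp (-(t - s) / ε) * (B t ω - B s ω) := by
  obtain ⟨hk, hk1⟩ := expKernel_integral hε t
  have e : (fun s => 1 / ε * Real.exp (-(t - s) / ε) * (B t ω - B s ω)) = fun s =>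
      1 / ε * Real.exp (-(t - s) / ε) * B t ω - 1 / ε * (Real.exp (-(t - s) / ε) * B s ω) := by
    ext s; ring
  rw [e]
  refine ⟨(hk.mul_const _).sub (hinteg.const_mul _), ?_⟩
  rw [integral_sub (hk.mul_const _) (hinteg.const_mul _), integral_mul_const, hk1,
    integral_const_mul, one_mul]
  rfl

variable [MeasureSpace Ω] {H : ℝ}

lemma slowX_eq {σ ε : ℝ} (hε : 0 < ε) {ω : Ω} (hc : Continuous fun t => B t ω)
    (hinteg : ∀ t, IntegrableOn (fun s => Real.exp (-(t - s) / ε) * B s ω) (Set.Iic t)) (t : ℝ) :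
    slowX H σ ε B t ω = σ * ((B t ω - unitOU ε B t ω) - (B 0 ω - unitOU ε B 0 ω)) := by
  have h := integral_sub_expConv hc hinteg 0 t
  have e : ∀ s, fracOU H σ ε B s ω =
      σ / ε ^ H * (B s ω - 1 / ε * expConv ε (fun s => B s ω) s) := fun s => rfl
  have hp : ε ^ (H - 1) = ε ^ H / ε := Real.rpow_sub_one hε.ne' H
  have hp0 : ε ^ H ≠ 0 := (Real.rpow_pos_of_pos hε H).ne'
  simp_rw [slowX, e]
  rw [intervalIntegral.integral_const_mul, h, hp, unitOU, unitOU]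
  field_simp
  ring

lemma slowX_increment {σ ε : ℝ} (hε : 0 < ε) {ω : Ω} (hc : Continuous fun t => B t ω)
    (hinteg : ∀ t, IntegrableOn (fun s => Real.exp (-(t - s) / ε) * B s ω) (Set.Iic t)) (a b : ℝ) :
    slowX H σ ε B b ω - slowX H σ ε B a ω =
      σ * ((B b ω - B a ω) - (unitOU ε B b ω - unitOU ε B a ω)) := by
  rw [slowX_eq hε hc hinteg, slowX_eq hε hc hinteg]; ring

/-- The fourth power of the normalized fractional Ornstein–Uhlenbeck process is dominated by an
integrable variable with the expected scaling in `ε`. -/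
lemma IsTwoSidedFBM.exists_dominating_unitOU [IsProbabilityMeasure (ℙ : Measure Ω)]
    (hB : IsTwoSidedFBM H B) (hH : 0 < H) {ε : ℝ} (hε : 0 < ε)
    (hinteg : ∀ᵐ ω : Ω, ∀ t, IntegrableOn (fun s => Real.exp (-(t - s) / ε) * B s ω) (Set.Iic t))
    (t : ℝ) :
    ∃ D : Ω → ℝ, Integrable D ∧ ∫ ω, D ω = 3 * Real.Gamma (4 * H + 1) * ε ^ (4 * H) ∧
      ∀ᵐ ω : Ω, unitOU ε B t ω ^ 4 ≤ D ω := by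
  obtain ⟨G, hG, hGm, hGc⟩ := Filter.Eventually.exists_measurable_mem hB.cont
  set B' : ℝ → Ω → ℝ := fun t => G.indicator (B t) with hB'
  have hB'm : ∀ t, Measurable (B' t) := fun t => (hB.meas t).indicator hGm
  have hB'c : ∀ ω, Continuous fun t => B' t ω := by
    intro ω
    by_cases hω : ω ∈ G
    · simpa [hB', hω] using hGc ω hω
    · simpa [hB', hω] using continuous_const
  have hB'e : ∀ ω ∈ G, ∀ t, B' t ω = B t ω := fun ω hω t => Set.indicator_of_mem hω _
  have hjoint : Measurable fun p : Ω × ℝ => B' p.2 p.1 :=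
    (measurable_uncurry_of_continuous_of_measurable hB'c hB'm).comp measurable_swap
  set F : Ω × ℝ → ℝ := fun p =>
    1 / ε * Real.exp (-(t - p.2) / ε) * (B' t p.1 - B' p.2 p.1) ^ 4 with hF
  have hFm : Measurable F := by
    have hBt : Measurable fun p : Ω × ℝ => B' t p.1 := (hB'm t).comp measurable_fst
    have hexp : Measurable fun p : Ω × ℝ => 1 / ε * Real.exp (-(t - p.2) / ε) := by fun_prop
    exact hexp.mul ((hBt.sub hjoint).pow_const 4)
  have hF0 : ∀ p, 0 ≤ F p := fun p => by
    have : 0 ≤ (B' t p.1 - B' p.2 p.1) ^ 4 := by positivity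
    positivity
  have hFs : ∀ s, Integrable (fun ω => F (ω, s)) ∧
      ∫ ω, F (ω, s) = 3 * (1 / ε * Real.exp (-(t - s) / ε) * |t - s| ^ (4 * H)) := by
    intro s
    have hm : Measurable fun ω => B t ω - B s ω := (hB.meas t).sub (hB.meas s)
    have hlaw := hB.map_sub hH s t
    have hI := (integrable_pow_four_of_gaussian hm hlaw).const_mul
      (1 / ε * Real.exp (-(t - s) / ε))
    have hE := integral_pow_four_of_gaussian hm hlaw
    have hae : (fun ω => 1 / ε * Real.exp (-(t - s) / ε) * (B t ω - B s ω) ^ 4) =ᵐ[ℙ]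
        fun ω => F (ω, s) := by
      filter_upwards [hG] with ω hω
      simp only [hF, hB'e ω hω]
    refine ⟨hI.congr hae, ?_⟩
    rw [← integral_congr_ae hae, integral_const_mul, hE,
      Real.coe_toNNReal _ (Real.rpow_nonneg (abs_nonneg _) _), ← Real.rpow_natCast (_ ^ _),
      ← Real.rpow_mul (abs_nonneg _), show 2 * H * ((2 : ℕ) : ℝ) = 4 * H by push_cast; ring]
    ring
  obtain ⟨hk, hk1⟩ := expKernel_moment hε (by positivity : 0 ≤ 4 * H) t
  have hFi : Integrable F ((ℙ : Measure Ω).prod (volume.restrict (Set.Iic t))) := by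
    rw [integrable_prod_iff' hFm.aestronglyMeasurable]
    refine ⟨Eventually.of_forall fun s => (hFs s).1, ?_⟩
    simp_rw [Real.norm_of_nonneg (hF0 _), (hFs _).2]
    exact hk.const_mul 3
  refine ⟨fun ω => ∫ s in Set.Iic t, F (ω, s), hFi.integral_prod_left, ?_, ?_⟩
  · rw [integral_integral_swap (f := fun ω s => F (ω, s)) hFi]
    simp_rw [(hFs _).2]
    rw [integral_const_mul, hk1]
    ring
  · obtain ⟨hk, hk1⟩ := expKernel_integral hε t
    filter_upwards [hG, hinteg, hFi.prod_right_ae] with ω hω hi hFω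
    obtain ⟨h1, h2⟩ := unitOU_eq hε (hi t)
    rw [h2]
    have e : (fun s => F (ω, s)) = fun s =>
        1 / ε * Real.exp (-(t - s) / ε) * (B t ω - B s ω) ^ 4 := by
      ext s; simp only [hF, hB'e ω hω]
    rw [e] at hFω ⊢
    exact pow_four_integral_le (fun s => by positivity) hk hk1 h1 hFω

end OrnsteinUhlenbeck

section Estimator

/-- Perturbation bound for a normalized squared norm. -/
lemma sq_normSq_sub_one_le {N : ℕ} (hN : 0 < N) {ρ : ℝ} (hρ : 0 < ρ) (u w : Fin N → ℝ) :
    (1 / (N : ℝ) * ((u - w) ⬝ᵥ (u - w)) - 1) ^ 2 ≤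
      9 / (N : ℝ) ^ 2 * (u ⬝ᵥ u - N) ^ 2 + 6 * ρ + (9 + 6 / ρ) * (w ⬝ᵥ w / N) ^ 2 := by
  have hN' : (0 : ℝ) < N := by exact_mod_cast hN
  have hcs : (u ⬝ᵥ w) ^ 2 ≤ (u ⬝ᵥ u) * (w ⬝ᵥ w) := by
    simpa only [dotProduct, sq] using Finset.sum_mul_sq_le_sq_mul_sq Finset.univ u w
  have hexp : (u - w) ⬝ᵥ (u - w) = u ⬝ᵥ u - 2 * (u ⬝ᵥ w) + w ⬝ᵥ w := by
    rw [sub_dotProduct, dotProduct_sub, dotProduct_sub, dotProduct_comm w u]; ring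
  rw [hexp]
  set S := u ⬝ᵥ u / N with hS
  set X := u ⬝ᵥ w / N with hX
  set R := w ⬝ᵥ w / N with hR
  have hX2 : X ^ 2 ≤ S * R := by
    rw [hX, hS, hR, div_pow, div_mul_div_comm, ← sq]
    gcongr
  have e1 : 1 / (N : ℝ) * (u ⬝ᵥ u - 2 * (u ⬝ᵥ w) + w ⬝ᵥ w) - 1 = (S - 1) - 2 * X + R := by
    rw [hX, hS, hR]; field_simp; ring
  have e2 : 9 / (N : ℝ) ^ 2 * (u ⬝ᵥ u - N) ^ 2 = 9 * (S - 1) ^ 2 := by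
    rw [hS]; field_simp
  have hR1 : 12 * R ≤ 6 * ρ + 6 / ρ * R ^ 2 := by
    have h : 0 ≤ 6 / ρ * (R - ρ) ^ 2 := by positivity
    have h' : 6 / ρ * (R - ρ) ^ 2 = 6 / ρ * R ^ 2 - 12 * R + 6 * ρ := by field_simp; ring
    linarith
  rw [e1, e2]
  nlinarith [sq_nonneg (S - 1 + 2 * X), sq_nonneg (S - 1 - R), sq_nonneg (2 * X + R)]

lemma sub_pow_four_le (x y : ℝ) : (x - y) ^ 4 ≤ 8 * (x ^ 4 + y ^ 4) := by
  nlinarith [sq_nonneg (x ^ 2 - y ^ 2), sq_nonneg (x * (x + y)), sq_nonneg (y * (x + y)),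
    sq_nonneg (x + y), sq_nonneg ((x + y) ^ 2), mul_nonneg (sq_nonneg (x + y)) (sq_nonneg (x - y))]

variable {Ω : Type*} [MeasureSpace Ω] {H : ℝ} {B : ℝ → Ω → ℝ}

/-- Non-asymptotic bound for the mean squared error of the estimator. -/
lemma IsTwoSidedFBM.mse_le [IsProbabilityMeasure (ℙ : Measure Ω)] (hB : IsTwoSidedFBM H B)
    (hH : 0 < H) {σ ε δ c : ℝ} (hε : 0 < ε) (hδ : 0 < δ) (hc : 0 < c) {N : ℕ} (hN : 0 < N)
    (hInt : ∀ᵐ ω : Ω, ∀ t : ℝ,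
      IntegrableOn (fun s => Real.exp (-(t - s) / ε) * |B s ω|) (Set.Iic t))
    (hLB : ∀ b : Fin N → ℝ, c * (b ⬝ᵥ b) ≤ b ⬝ᵥ (SigmaH H δ N *ᵥ b)) {ρ : ℝ}
    (hρ : ρ = 4 * (3 * Real.Gamma (4 * H + 1) + 1) * ε ^ (2 * H) / c) :
    ∫ ω, (sigmaHat2 H σ ε δ B N ω - σ ^ 2) ^ 2 ≤
      σ ^ 4 * (18 / N + 12 * ρ + 9 * ρ ^ 2) := by
  have hN' : (0 : ℝ) < N := by exact_mod_cast hN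
  have hΓ : 0 < Real.Gamma (4 * H + 1) := Real.Gamma_pos_of_pos (by linarith)
  have hε' : 0 < ε ^ (2 * H) := Real.rpow_pos_of_pos hε _
  have hρ0 : 0 < ρ := by rw [hρ]; positivity
  have hinteg : ∀ᵐ ω : Ω, ∀ t : ℝ,
      IntegrableOn (fun s => Real.exp (-(t - s) / ε) * B s ω) (Set.Iic t) := by
    filter_upwards [hInt, hB.cont] with ω h hcω t
    refine (h t).mono' (Continuous.aestronglyMeasurable (by fun_prop)) ?_
    exact Eventually.of_forall fun s => by
      rw [norm_mul, Real.norm_eq_abs, Real.norm_eq_abs, Real.abs_exp]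
  obtain ⟨A, hA1, hA2, hA3⟩ := exists_whitening (SigmaH H δ N) (SigmaH_isSymm H δ N) hc hLB
  obtain ⟨hUi, hUv⟩ := hB.chiSq hδ hA2
  set U : Ω → Fin N → ℝ := fun ω k => B (((k : ℕ) + 1 : ℝ) * δ) ω - B ((k : ℕ) * δ) ω with hU
  choose D hDi hDv hD using fun t => hB.exists_dominating_unitOU hH hε hinteg t
  set E : Ω → ℝ := fun ω =>
    ∑ k : Fin N, 8 * (D (((k : ℕ) + 1 : ℝ) * δ) ω + D ((k : ℕ) * δ) ω) with hE
  have hEi : Integrable E := integrable_finsetSum _ fun k _ => ((hDi _).fun_add (hDi _)).const_mul _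
  have hEv : ∫ ω, E ω = N * (48 * Real.Gamma (4 * H + 1) * ε ^ (4 * H)) := by
    rw [hE, integral_finsetSum _ fun k _ => ((hDi _).fun_add (hDi _)).const_mul _]
    simp_rw [integral_const_mul, integral_add (hDi _) (hDi _), hDv]
    simp only [Finset.sum_const, Finset.card_univ, Fintype.card_fin, nsmul_eq_mul]
    ring
  set F : Ω → ℝ := fun ω => 9 / (N : ℝ) ^ 2 * ((A *ᵥ U ω) ⬝ᵥ (A *ᵥ U ω) - N) ^ 2 + 6 * ρ +
    (9 + 6 / ρ) * (c⁻¹ ^ 2 / N * E ω) with hF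
  have hFi : Integrable F := ((hUi.const_mul _).fun_add (integrable_const _)).fun_add
    ((hEi.const_mul _).const_mul _)
  have hFv : ∫ ω, F ω = 18 / N + 6 * ρ +
      (9 + 6 / ρ) * (c⁻¹ ^ 2 * (48 * Real.Gamma (4 * H + 1) * ε ^ (4 * H))) := by
    rw [hF, integral_add ((hUi.const_mul _).fun_add (integrable_const _))
      ((hEi.const_mul _).const_mul _), integral_add (hUi.const_mul _) (integrable_const _),
      integral_const_mul, integral_const_mul (9 + 6 / ρ), integral_const_mul (c⁻¹ ^ 2 / N),
      hUv, hEv, integral_const, probReal_univ, one_smul]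
    field_simp
    ring
  have hbound : ∀ᵐ ω : Ω, (sigmaHat2 H σ ε δ B N ω - σ ^ 2) ^ 2 ≤ σ ^ 4 * F ω := by
    have hDall : ∀ᵐ ω : Ω, ∀ k : Fin N,
        unitOU ε B (((k : ℕ) + 1 : ℝ) * δ) ω ^ 4 ≤ D (((k : ℕ) + 1 : ℝ) * δ) ω ∧
        unitOU ε B ((k : ℕ) * δ) ω ^ 4 ≤ D ((k : ℕ) * δ) ω :=
      ae_all_iff.2 fun k => (hD _).and (hD _)
    filter_upwards [hinteg, hB.cont, hDall] with ω hω hcω hDω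
    set W : Fin N → ℝ := fun k =>
      unitOU ε B (((k : ℕ) + 1 : ℝ) * δ) ω - unitOU ε B ((k : ℕ) * δ) ω with hW
    have hV : incVec H σ ε δ B N ω = σ • (U ω - W) := by
      ext k
      exact slowX_increment hε hcω hω _ _
    have hest : sigmaHat2 H σ ε δ B N ω =
        σ ^ 2 * (1 / (N : ℝ) * ((A *ᵥ U ω - A *ᵥ W) ⬝ᵥ (A *ᵥ U ω - A *ᵥ W))) := by
      rw [sigmaHat2, hA1, hV, mulVec_smul, mulVec_sub, smul_dotProduct, dotProduct_smul,
        smul_eq_mul, smul_eq_mul]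
      ring
    have hWW : (W ⬝ᵥ W) ^ 2 ≤ N * E ω := by
      have h1 : (W ⬝ᵥ W) ^ 2 ≤ N * ∑ k, (W k ^ 2) ^ 2 := by
        have := sq_sum_le_card_mul_sum_sq (s := (Finset.univ : Finset (Fin N)))
          (f := fun k => W k ^ 2)
        simpa [dotProduct, ← sq] using this
      refine h1.trans ?_
      refine mul_le_mul_of_nonneg_left (Finset.sum_le_sum fun k _ => ?_) hN'.le
      have h2 := sub_pow_four_le (unitOU ε B (((k : ℕ) + 1 : ℝ) * δ) ω)
        (unitOU ε B ((k : ℕ) * δ) ω)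
      rw [← pow_mul]
      exact h2.trans (by linarith [(hDω k).1, (hDω k).2])
    have hR : ((A *ᵥ W) ⬝ᵥ (A *ᵥ W) / N) ^ 2 ≤ c⁻¹ ^ 2 / N * E ω := by
      have h0 : 0 ≤ (A *ᵥ W) ⬝ᵥ (A *ᵥ W) := by
        rw [dotProduct]; exact Finset.sum_nonneg fun i _ => mul_self_nonneg _
      calc ((A *ᵥ W) ⬝ᵥ (A *ᵥ W) / N) ^ 2 ≤ (c⁻¹ * (W ⬝ᵥ W) / N) ^ 2 := by
            gcongr
            exact hA3 W
        _ = c⁻¹ ^ 2 / N ^ 2 * (W ⬝ᵥ W) ^ 2 := by ring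
        _ ≤ c⁻¹ ^ 2 / N ^ 2 * (N * E ω) := by gcongr
        _ = c⁻¹ ^ 2 / N * E ω := by field_simp
    rw [hest, show ∀ x : ℝ, (σ ^ 2 * x - σ ^ 2) ^ 2 = σ ^ 4 * (x - 1) ^ 2 from fun x => by ring]
    refine mul_le_mul_of_nonneg_left ?_ (by positivity)
    refine (sq_normSq_sub_one_le hN hρ0 _ _).trans ?_
    have h9 : 0 ≤ 9 + 6 / ρ := by positivity
    exact add_le_add le_rfl (mul_le_mul_of_nonneg_left hR h9)
  have hmono : ∫ ω, (sigmaHat2 H σ ε δ B N ω - σ ^ 2) ^ 2 ≤ ∫ ω, σ ^ 4 * F ω :=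
    integral_mono_of_nonneg (Eventually.of_forall fun _ => sq_nonneg _) (hFi.const_mul _) hbound
  have hρ2 : c⁻¹ ^ 2 * (48 * Real.Gamma (4 * H + 1) * ε ^ (4 * H)) ≤ ρ ^ 2 := by
    have e : ε ^ (4 * H) = (ε ^ (2 * H)) ^ 2 := by
      rw [sq, ← Real.rpow_add hε]; congr 1; ring
    have e' : ρ ^ 2 =
        c⁻¹ ^ 2 * (16 * (3 * Real.Gamma (4 * H + 1) + 1) ^ 2 * (ε ^ (2 * H)) ^ 2) := by
      rw [hρ]; field_simp; ring
    rw [e, e']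
    have hk : 48 * Real.Gamma (4 * H + 1) ≤ 16 * (3 * Real.Gamma (4 * H + 1) + 1) ^ 2 := by
      nlinarith
    gcongr ?_ * (?_ * _)
  refine hmono.trans ?_
  rw [integral_const_mul, hFv]
  refine mul_le_mul_of_nonneg_left ?_ (by positivity)
  have h3 : (9 + 6 / ρ) * (c⁻¹ ^ 2 * (48 * Real.Gamma (4 * H + 1) * ε ^ (4 * H))) ≤
      (9 + 6 / ρ) * ρ ^ 2 := by gcongr
  have h4 : (9 + 6 / ρ) * ρ ^ 2 = 9 * ρ ^ 2 + 6 * ρ := by field_simp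
  linarith

end Estimator

/-- L² consistency of the MLE-type estimator in the physical fractional Brownian motion
model under the subsampling condition `δ = ε^α`, `0 < α < min{1, H/(1−H)}`. -/
theorem sigmaHat2_L2_consistent
    {Ω : Type*} [MeasureSpace Ω] [IsProbabilityMeasure (ℙ : Measure Ω)]
    (H σ T α : ℝ) (hH : H ∈ Set.Ioo (0 : ℝ) 1) (hσ : 0 < σ) (hT : 0 < T)
    (hα0 : 0 < α) (hα : α < min 1 (H / (1 - H)))
    (B : ℝ → Ω → ℝ) (hB : IsTwoSidedFBM H B)
    (hInt : ∀ ε : ℝ, 0 < ε → ∀ᵐ ω : Ω, ∀ t : ℝ,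
      IntegrableOn (fun s => Real.exp (-(t - s) / ε) * |B s ω|) (Set.Iic t))
    (εs : ℕ → ℝ) (Ns : ℕ → ℕ)
    (hεpos : ∀ n, 0 < εs n) (hε0 : Tendsto εs atTop (𝓝 0))
    (hNpos : ∀ n, 0 < Ns n) (hNs : ∀ n, (Ns n : ℝ) = T / (εs n) ^ α) :
    Tendsto (fun n => ∫ ω, (sigmaHat2 H σ (εs n) ((εs n) ^ α) B (Ns n) ω - σ ^ 2) ^ 2)
      atTop (𝓝 0) := by
  obtain ⟨hH0, hH1⟩ := hH
  obtain ⟨κ, hκ, hLB⟩ := SigmaH_lower_bound ⟨hH0, hH1⟩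
  obtain ⟨hα1, hαH⟩ := lt_min_iff.1 hα
  have hαH' : α * (1 - H) < H := (lt_div_iff₀ (by linarith)).1 hαH
  set p := max 0 (1 - 2 * H) with hp
  set C := 4 * (3 * Real.Gamma (4 * H + 1) + 1) * κ⁻¹ * T ^ p with hC
  set γ := 2 * H - 2 * H * α - p * α with hγ
  have hγ0 : 0 < γ := by
    rcases le_total 0 (1 - 2 * H) with h | h
    · rw [hγ, hp, max_eq_right h]
      nlinarith
    · rw [hγ, hp, max_eq_left h]
      nlinarith
  have hpow : ∀ q : ℝ, 0 < q → Tendsto (fun n => εs n ^ q) atTop (𝓝 0) := fun q hq => by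
    have := hε0.rpow_const (p := q) (Or.inr hq.le)
    rwa [Real.zero_rpow hq.ne'] at this
  have hlim : Tendsto (fun n => σ ^ 4 * (18 / T * εs n ^ α + 12 * (C * εs n ^ γ)
      + 9 * (C * εs n ^ γ) ^ 2)) atTop (𝓝 0) := by
    have hγl := (hpow γ hγ0).const_mul C
    have := ((((hpow α hα0).const_mul (18 / T)).add (hγl.const_mul 12)).add
      ((hγl.pow 2).const_mul 9)).const_mul (σ ^ 4)
    simpa using this
  refine squeeze_zero (fun n => integral_nonneg fun ω => sq_nonneg _) (fun n => ?_) hlim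
  have hε := hεpos n
  have hδ : 0 < εs n ^ α := Real.rpow_pos_of_pos hε _
  have hN : (0 : ℝ) < Ns n := by exact_mod_cast hNpos n
  have hc : 0 < κ * (εs n ^ α) ^ (2 * H) * (Ns n : ℝ) ^ (-p) := by positivity
  have h := hB.mse_le (σ := σ) hH0 hε hδ hc (hNpos n) (hInt _ hε) (hLB _ _ (hNpos n) hδ) rfl
  refine h.trans_eq ?_
  have e1 : 18 / (Ns n : ℝ) = 18 / T * εs n ^ α := by
    rw [hNs]; field_simp
  have e2 : 4 * (3 * Real.Gamma (4 * H + 1) + 1) * εs n ^ (2 * H) /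
      (κ * (εs n ^ α) ^ (2 * H) * (Ns n : ℝ) ^ (-p)) = C * εs n ^ γ := by
    have e3 : εs n ^ γ = εs n ^ (2 * H) / (εs n ^ α) ^ (2 * H) / (εs n ^ α) ^ p := by
      rw [← Real.rpow_mul hε.le, ← Real.rpow_mul hε.le, ← Real.rpow_sub hε, ← Real.rpow_sub hε]
      congr 1
      rw [hγ]; ring
    rw [e3, hC, Real.rpow_neg hN.le, hNs, Real.div_rpow hT.le hδ.le]
    field_simp
  rw [e1, e2]
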